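/- arXiv:2010.10765 — 2 statements merged into one kernel-verified Lean document; each statement's English description precedes it below -/
import Mathlib

section
/- Let Λ be a left and right noetherian ring and let M, N be finitely generated Λ-modules. Suppose there is a short exact sequence 0 → M^{⊕a} → N → Ω^n M^{⊕b} → 0 with a, b > 0 and n ≥ 0, that N is totally reflexive, and that Ext^i_Λ(M, Λ) = 0 for all i ≥ 1. Then M is totally reflexive. -/
/-!
Formalization of a statement from:
T. Araya and R. Takahashi, "On reducing homological dimensions over noetherian
rings" (arXiv:2010.10765).
-/

open Function Filter CategoryTheory

universe u

/-- A resolution of `M` by finitely generated free `A`-modules: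
`⋯ → A^{rank 2} → A^{rank 1} → A^{rank 0} → M → 0`. -/
structure FreeResolution (A : Type u) [Ring A] (M : Type u) [AddCommGroup M]
    [Module A M] where
  rank : ℕ → ℕ
  d : ∀ i : ℕ, ((Fin (rank (i + 1)) → A) →ₗ[A] (Fin (rank i) → A))
  aug : (Fin (rank 0) → A) →ₗ[A] M
  aug_surjective : Function.Surjective aug
  exact_aug : Function.Exact (d 0) aug
  exact : ∀ i : ℕ, Function.Exact (d (i + 1)) (d i)

/-- `ExtVanish A M N j` says that `Ext_A^{j+1}(M, N) = 0`: for every resolution `F`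
of `M` by finitely generated free modules, the complex `Hom_A(F, N)` is exact at
homological position `j + 1`. -/
def ExtVanish (A : Type u) [Ring A] (M : Type u) [AddCommGroup M] [Module A M]
    (N : Type u) [AddCommGroup N] [Module A N] (j : ℕ) : Prop :=
  ∀ F : FreeResolution A M,
    Function.Exact
      (fun φ : (Fin (F.rank j) → A) →ₗ[A] N => φ.comp (F.d j))
      (fun φ : (Fin (F.rank (j + 1)) → A) →ₗ[A] N => φ.comp (F.d (j + 1)))

/-- `extNonzero A M N i` says that `Ext_A^i(M, N) ≠ 0`
(for `i = 0` this reads `Hom_A(M, N) ≠ 0`). -/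
def extNonzero (A : Type u) [Ring A] (M : Type u) [AddCommGroup M] [Module A M]
    (N : Type u) [AddCommGroup N] [Module A N] : ℕ → Prop
  | 0 => ∃ φ : M →ₗ[A] N, φ ≠ 0
  | (j + 1) => ¬ ExtVanish A M N j

/-- The `A`-dual `Hom_A(-, A)`, as an `Aᵐᵒᵖ`-linear map between dual modules. -/
def dualMap {A : Type u} [Ring A] {M N : Type u} [AddCommGroup M] [Module A M]
    [AddCommGroup N] [Module A N] (f : M →ₗ[A] N) :
    (N →ₗ[A] A) →ₗ[Aᵐᵒᵖ] (M →ₗ[A] A) where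
  toFun φ := φ.comp f
  map_add' _ _ := rfl
  map_smul' _ _ := rfl

/-- The (Auslander) transpose of `M` computed from the finite free presentation
`A^{rank 1} → A^{rank 0} → M → 0` contained in the resolution `F`, that is, the
cokernel of `Hom_A(A^{rank 0}, A) → Hom_A(A^{rank 1}, A)`; it is an `Aᵐᵒᵖ`-module
(i.e. a module on the other side), well defined up to projective summands. -/
abbrev FreeResolution.transpose {A : Type u} [Ring A] {M : Type u} [AddCommGroup M]
    [Module A M] (F : FreeResolution A M) : Type u :=
  ((Fin (F.rank 1) → A) →ₗ[A] A) ⧸ LinearMap.range (dualMap (F.d 0))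

/-- `M` is `(m,n)`-torsionfree: `Ext_A^i(M, A) = 0` for all `1 ≤ i ≤ m` and
`Ext_{Aᵒᵖ}^j(tr M, A) = 0` for all `1 ≤ j ≤ n` (read as "for all `i ≥ 1`", resp.
"for all `j ≥ 1`", when `m = ∞`, resp. `n = ∞`). -/
def IsMNTorsionFree (A : Type u) [Ring A] (M : Type u) [AddCommGroup M] [Module A M]
    (m n : ℕ∞) : Prop :=
  (∀ j : ℕ, (j : ℕ∞) + 1 ≤ m → ExtVanish A M A j) ∧
  (∀ F : FreeResolution A M, ∀ j : ℕ, (j : ℕ∞) + 1 ≤ n →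
    ExtVanish Aᵐᵒᵖ F.transpose A j)

/-- `M` is totally reflexive (= Gorenstein projective), i.e. `(∞,∞)`-torsionfree:
`Ext_A^i(M, A) = 0 = Ext_{Aᵒᵖ}^i(tr M, A)` for all `i ≥ 1`. -/
def IsTotallyReflexive (A : Type u) [Ring A] (M : Type u) [AddCommGroup M]
    [Module A M] : Prop :=
  IsMNTorsionFree A M ⊤ ⊤

/-- `M` has finite projective dimension: it admits a finite resolution by finitely
generated free modules. -/
def HasFinitePd (A : Type u) [Ring A] (M : Type u) [AddCommGroup M] [Module A M] :
    Prop :=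
  ∃ F : FreeResolution A M, ∃ t : ℕ, ∀ i : ℕ, t ≤ i → F.rank i = 0

/-- `GdimLE A t M` : the Gorenstein dimension of `M` is at most `t`, i.e. `M` admits
a resolution `0 → G_t → ⋯ → G_0 → M → 0` by totally reflexive modules. -/
def GdimLE (A : Type u) [Ring A] :
    ℕ → ∀ (M : Type u) [AddCommGroup M] [Module A M], Prop
  | 0, M, _, _ => IsTotallyReflexive A M
  | (t + 1), M, _, _ =>
      ∃ (G : Type u) (_ : AddCommGroup G) (_ : Module A G) (g : G →ₗ[A] M),
        IsTotallyReflexive A G ∧ Function.Surjective g ∧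
        GdimLE A t (LinearMap.ker g)

/-- `M` has finite Gorenstein dimension. -/
def HasFiniteGdim (A : Type u) [Ring A] (M : Type u) [AddCommGroup M] [Module A M] :
    Prop :=
  ∃ t : ℕ, GdimLE A t M

/-- The Gorenstein dimension of `M`, as an element of `ℕ∞` (`⊤` if infinite). -/
noncomputable def gdimension (A : Type u) [Ring A] (M : Type u) [AddCommGroup M]
    [Module A M] : ℕ∞ :=
  sInf {s : ℕ∞ | ∃ t : ℕ, s = t ∧ GdimLE A t M}

/-- `IsNthSyzygy A M t S` : `S` is a `t`-th syzygy `Ω^t M` of `M`, computed from a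
resolution of `M` by finitely generated free modules (with `Ω^0 M = M`). -/
def IsNthSyzygy (A : Type u) [Ring A] (M : Type u) [AddCommGroup M] [Module A M] :
    ℕ → ∀ (S : Type u) [AddCommGroup S] [Module A S], Prop
  | 0, S, _, _ => Nonempty (S ≃ₗ[A] M)
  | (j + 1), S, _, _ =>
      ∃ F : FreeResolution A M, Nonempty (S ≃ₗ[A] LinearMap.range (F.d j))

/-- `RedChain A fin s M` : there are short exact sequences
`0 → M_{i-1}^{⊕ a_i} → M_i → Ω^{n_i} M_{i-1}^{⊕ b_i} → 0` (`i = 1, …, s`) of finitely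
generated `A`-modules with `n_i ≥ 0`, `a_i, b_i > 0`, `M₀ = M` and `fin (M_s)`. -/
def RedChain (A : Type u) [Ring A]
    (fin : ∀ (M : Type u) [AddCommGroup M] [Module A M], Prop) :
    ℕ → ∀ (M : Type u) [AddCommGroup M] [Module A M], Prop
  | 0, M, _, _ => fin M
  | (s + 1), M, _, _ =>
      ∃ (M₁ : Type u) (_ : AddCommGroup M₁) (_ : Module A M₁)
        (_ : Module.Finite A M₁)
        (S : Type u) (_ : AddCommGroup S) (_ : Module A S) (_ : Module.Finite A S)
        (a b n : ℕ) (f : (Fin a → M) →ₗ[A] M₁) (g : M₁ →ₗ[A] (Fin b → S)),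
        0 < a ∧ 0 < b ∧ IsNthSyzygy A M n S ∧
        Function.Injective f ∧ Function.Surjective g ∧ Function.Exact f g ∧
        RedChain A fin s M₁

/-- `URedChain A fin s M` : there are short exact sequences
`0 → M_{i-1} → M_i → Ω^{n_i} M_{i-1} → 0` (`i = 1, …, s`) of finitely generated
`A`-modules with `n_i ≥ 0`, `M₀ = M` and `fin (M_s)`. -/
def URedChain (A : Type u) [Ring A]
    (fin : ∀ (M : Type u) [AddCommGroup M] [Module A M], Prop) :
    ℕ → ∀ (M : Type u) [AddCommGroup M] [Module A M], Prop
  | 0, M, _, _ => fin M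
  | (s + 1), M, _, _ =>
      ∃ (M₁ : Type u) (_ : AddCommGroup M₁) (_ : Module A M₁)
        (_ : Module.Finite A M₁)
        (S : Type u) (_ : AddCommGroup S) (_ : Module A S) (_ : Module.Finite A S)
        (n : ℕ) (f : M →ₗ[A] M₁) (g : M₁ →ₗ[A] S),
        IsNthSyzygy A M n S ∧
        Function.Injective f ∧ Function.Surjective g ∧ Function.Exact f g ∧
        URedChain A fin s M₁

/-- The reducing dimension of `M` with respect to the homological dimension whose
finiteness is recorded by the predicate `fin`: taking `fin = HasFinitePd A` gives
the reducing projective dimension `red-pd_A M`, and `fin = HasFiniteGdim A` gives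
the reducing Gorenstein dimension `red-Gdim_A M`.  It is the least length of a
chain of short exact sequences as in `RedChain` (`0` iff `fin M` holds, `⊤` if
there is no such chain). -/
noncomputable def redDim (A : Type u) [Ring A]
    (fin : ∀ (M : Type u) [AddCommGroup M] [Module A M], Prop)
    (M : Type u) [AddCommGroup M] [Module A M] : ℕ∞ :=
  sInf {s : ℕ∞ | ∃ t : ℕ, s = t ∧ RedChain A fin t M}

/-- The upper reducing dimension of `M` with respect to `fin`: taking
`fin = HasFinitePd A` gives the upper reducing projective dimension, and
`fin = HasFiniteGdim A` gives the upper reducing Gorenstein dimension. -/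
noncomputable def uredDim (A : Type u) [Ring A]
    (fin : ∀ (M : Type u) [AddCommGroup M] [Module A M], Prop)
    (M : Type u) [AddCommGroup M] [Module A M] : ℕ∞ :=
  sInf {s : ℕ∞ | ∃ t : ℕ, s = t ∧ URedChain A fin t M}

open Abelian

/-- `Ext_R^n(X, Y) = 0`, in terms of the `Ext`-groups of the category of modules. -/
def ExtZero (R : Type u) [Ring R] (X Y : Type u) [AddCommGroup X] [Module R X]
    [AddCommGroup Y] [Module R Y] (n : ℕ) : Prop :=
  Subsingleton (Ext.{u} (ModuleCat.of R X) (ModuleCat.of R Y) n)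

section ExtZero

variable {R : Type u} [Ring R] {X Y Z W : Type u} [AddCommGroup X] [Module R X]
  [AddCommGroup Y] [Module R Y] [AddCommGroup Z] [Module R Z] [AddCommGroup W] [Module R W]

/-- The short exact sequence of modules, as a short exact complex in `ModuleCat R`. -/
theorem shortExact_moduleCat {f : X →ₗ[R] Y} {g : Y →ₗ[R] Z} (hf : Injective f)
    (hg : Surjective g) (hfg : Exact f g) :
    (ShortComplex.mk (ModuleCat.ofHom f) (ModuleCat.ofHom g)
      (by ext x; exact hfg.apply_apply_eq_zero x)).ShortExact where
  exact := by
    rw [ShortComplex.ShortExact.moduleCat_exact_iff_function_exact]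
    exact hfg
  mono_f := (ModuleCat.mono_iff_injective _).2 hf
  epi_g := (ModuleCat.epi_iff_surjective _).2 hg

theorem extZero_of_projective [Module.Projective R X] (n : ℕ) : ExtZero R X W (n + 1) :=
  subsingleton_of_forall_eq 0 fun _ => Ext.eq_zero_of_projective _

theorem extZero_cokernel {f : X →ₗ[R] Y} {g : Y →ₗ[R] Z} (hf : Injective f)
    (hg : Surjective g) (hfg : Exact f g) {n : ℕ} (hX : ExtZero R X W n)
    (hY : ExtZero R Y W (n + 1)) : ExtZero R Z W (n + 1) := by
  have hS := shortExact_moduleCat hf hg hfg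
  refine subsingleton_of_forall_eq 0 fun e => ?_
  obtain ⟨e', rfl⟩ := Ext.contravariant_sequence_exact₃ hS _ e (hY.elim _ _) (add_comm 1 n)
  rw [hX.elim e' 0, Ext.comp_zero]

theorem extZero_kernel {f : X →ₗ[R] Y} {g : Y →ₗ[R] Z} (hf : Injective f)
    (hg : Surjective g) (hfg : Exact f g) {n : ℕ} (hZ : ExtZero R Z W (n + 1))
    (hY : ExtZero R Y W n) : ExtZero R X W n := by
  have hS := shortExact_moduleCat hf hg hfg
  refine subsingleton_of_forall_eq 0 fun e => ?_
  obtain ⟨e', rfl⟩ := Ext.contravariant_sequence_exact₁ hS _ e (add_comm 1 n) (hZ.elim _ _)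
  rw [hY.elim e' 0, Ext.comp_zero]

theorem extZero_one_of_forall_extend {f : X →ₗ[R] Y} {g : Y →ₗ[R] Z} (hf : Injective f)
    (hg : Surjective g) (hfg : Exact f g) (h : ∀ φ : X →ₗ[R] W, ∃ ψ : Y →ₗ[R] W, ψ ∘ₗ f = φ)
    (hY : ExtZero R Y W 1) : ExtZero R Z W 1 := by
  have hS := shortExact_moduleCat hf hg hfg
  refine subsingleton_of_forall_eq 0 fun e => ?_
  obtain ⟨e', rfl⟩ := Ext.contravariant_sequence_exact₃ hS _ e (hY.elim _ _) (add_comm 1 0)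
  obtain ⟨φ, rfl⟩ := (Ext.mk₀_bijective _ _).2 e'
  obtain ⟨ψ, hψ⟩ := h φ.hom
  have : φ = ModuleCat.ofHom f ≫ ModuleCat.ofHom ψ := ModuleCat.hom_ext hψ.symm
  rw [this, ← Ext.mk₀_comp_mk₀]
  exact hS.extClass_comp_assoc _

theorem exists_extend_of_extZero_one {f : X →ₗ[R] Y} {g : Y →ₗ[R] Z} (hf : Injective f)
    (hg : Surjective g) (hfg : Exact f g) (hZ : ExtZero R Z W 1) (φ : X →ₗ[R] W) :
    ∃ ψ : Y →ₗ[R] W, ψ ∘ₗ f = φ := by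
  have hS := shortExact_moduleCat hf hg hfg
  obtain ⟨e, he⟩ := Ext.contravariant_sequence_exact₁ hS _ (Ext.mk₀ (ModuleCat.ofHom φ))
    (add_comm 1 0) (hZ.elim _ _)
  obtain ⟨ψ, rfl⟩ := (Ext.mk₀_bijective _ _).2 e
  rw [Ext.mk₀_comp_mk₀] at he
  refine ⟨ψ.hom, ?_⟩
  have := congrArg ModuleCat.Hom.hom ((Ext.mk₀_bijective _ _).1 he)
  simpa using this

/-- `Ext`-vanishing passes to direct summands of finite direct sums. -/
theorem extZero_of_sum_comp_eq_id {ι : Type*} [Fintype ι] (p : ι → X →ₗ[R] Y)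
    (s : ι → Y →ₗ[R] X) (h : ∀ x, ∑ i, s i (p i x) = x) {n : ℕ} (hY : ExtZero R Y W n) :
    ExtZero R X W n := by
  refine subsingleton_of_forall_eq 0 fun e => ?_
  have hid : 𝟙 (ModuleCat.of R X) = ∑ i, ModuleCat.ofHom (p i) ≫ ModuleCat.ofHom (s i) := by
    ext x
    simpa [ModuleCat.hom_sum] using (h x).symm
  rw [← Ext.mk₀_id_comp e, hid, Ext.mk₀_sum, Ext.sum_comp]
  refine Finset.sum_eq_zero fun i _ => ?_
  rw [← Ext.mk₀_comp_mk₀_assoc, hY.elim ((Ext.mk₀ (ModuleCat.ofHom (s i))).comp e _) 0,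
    Ext.comp_zero]

theorem ExtZero.of_equiv {n : ℕ} (h : ExtZero R Y W n) (e : X ≃ₗ[R] Y) : ExtZero R X W n :=
  extZero_of_sum_comp_eq_id (fun _ : Unit => e.toLinearMap) (fun _ => e.symm.toLinearMap)
    (fun x => by simp) h

theorem ExtZero.pi {m n : ℕ} (h : ExtZero R Y W n) : ExtZero R (Fin m → Y) W n :=
  extZero_of_sum_comp_eq_id (fun i => LinearMap.proj i)
    (fun i => LinearMap.single R (fun _ => Y) i) (fun x => LinearMap.sum_single_apply _ x) h

/-- A linear map vanishing on the kernel of a surjection factors through it. -/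
theorem exists_factor_of_surjective {g : Y →ₗ[R] Z} (hg : Surjective g) (θ : Y →ₗ[R] W)
    (h : ∀ y, g y = 0 → θ y = 0) : ∃ θ' : Z →ₗ[R] W, θ' ∘ₗ g = θ := by
  refine ⟨(LinearMap.ker g).liftQ θ h ∘ₗ (g.quotKerEquivOfSurjective hg).symm, ?_⟩
  ext y
  have : (g.quotKerEquivOfSurjective hg).symm (g y) = (LinearMap.ker g).mkQ y := by
    rw [LinearEquiv.symm_apply_eq]; rfl
  exact (congrArg ((LinearMap.ker g).liftQ θ h) this).trans (Submodule.liftQ_apply _ _ _)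

end ExtZero

namespace FreeResolution

variable {R : Type u} [Ring R] {X W : Type u} [AddCommGroup X] [Module R X]
  [AddCommGroup W] [Module R W]

/-- The truncation of a free resolution of `X`, which resolves the first syzygy. -/
def tail (F : FreeResolution R X) : FreeResolution R (LinearMap.range (F.d 0)) where
  rank i := F.rank (i + 1)
  d i := F.d (i + 1)
  aug := (F.d 0).rangeRestrict
  aug_surjective := (F.d 0).surjective_rangeRestrict
  exact_aug x := by
    rw [← F.exact 0 x]
    exact Subtype.ext_iff
  exact i := F.exact (i + 1)

theorem exact_subtype_aug (F : FreeResolution R X) :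
    Exact (LinearMap.range (F.d 0)).subtype F.aug := by
  intro x
  rw [F.exact_aug x]
  simp

theorem exact_comp_iff_extZero (F : FreeResolution R X) (j : ℕ) :
    Exact (fun φ : (Fin (F.rank j) → R) →ₗ[R] W => φ.comp (F.d j))
      (fun φ : (Fin (F.rank (j + 1)) → R) →ₗ[R] W => φ.comp (F.d (j + 1))) ↔
    ExtZero R X W (j + 1) := by
  induction j generalizing X with
  | zero =>
    have hd : ∀ y, F.d 0 (F.d 1 y) = 0 := (F.exact 0).apply_apply_eq_zero
    constructor
    · intro h
      refine extZero_one_of_forall_extend (Submodule.subtype_injective _) F.aug_surjective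
        F.exact_subtype_aug (fun φ => ?_) (extZero_of_projective 0)
      obtain ⟨ψ, hψ⟩ := (h (φ ∘ₗ (F.d 0).rangeRestrict)).1 (LinearMap.ext fun y => by
        have : (F.d 0).rangeRestrict (F.d 1 y) = 0 := Subtype.ext (hd y)
        simp [this])
      refine ⟨ψ, LinearMap.ext ?_⟩
      rintro ⟨_, y, rfl⟩
      exact LinearMap.congr_fun hψ y
    · intro h φ
      constructor
      · intro hφ
        obtain ⟨θ, hθ⟩ := exists_factor_of_surjective (F.d 0).surjective_rangeRestrict φ
          fun y hy => by
            obtain ⟨z, rfl⟩ := (F.exact 0 y).1 (congrArg Subtype.val hy)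
            exact LinearMap.congr_fun hφ z
        obtain ⟨ψ, hψ⟩ := exists_extend_of_extZero_one (Submodule.subtype_injective _)
          F.aug_surjective F.exact_subtype_aug h θ
        refine ⟨ψ, ?_⟩
        rw [← hθ, ← hψ]
        rfl
      · rintro ⟨ψ, rfl⟩
        exact LinearMap.ext fun y => by simp [hd y]
  | succ j ih =>
    refine (ih F.tail).trans ⟨fun h => ?_, fun h => ?_⟩
    · exact extZero_cokernel (Submodule.subtype_injective _) F.aug_surjective
        F.exact_subtype_aug h (extZero_of_projective _)
    · exact extZero_kernel (Submodule.subtype_injective _) F.aug_surjective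
        F.exact_subtype_aug h (extZero_of_projective _)

/-- One step in the construction of a free resolution: cover the submodule `s.2` of
`R ^ s.1` by a finite free module and take the kernel. -/
theorem exists_cover [IsNoetherianRing R] (s : Σ r : ℕ, Submodule R (Fin r → R)) :
    ∃ (r : ℕ) (d : (Fin r → R) →ₗ[R] (Fin s.1 → R)), LinearMap.range d = s.2 := by
  obtain ⟨r, π, hπ⟩ := Module.Finite.exists_fin' R s.2
  refine ⟨r, s.2.subtype ∘ₗ π, ?_⟩
  rw [LinearMap.range_comp, LinearMap.range_eq_top.2 hπ, Submodule.map_top,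
    Submodule.range_subtype]

theorem nonempty [IsNoetherianRing R] [Module.Finite R X] : Nonempty (FreeResolution R X) := by
  choose r d hd using exists_cover (R := R)
  obtain ⟨r₀, π, hπ⟩ := Module.Finite.exists_fin' R X
  let s : ℕ → Σ r : ℕ, Submodule R (Fin r → R) := fun n =>
    Nat.rec ⟨r₀, LinearMap.ker π⟩ (fun _ s => ⟨r s, LinearMap.ker (d s)⟩) n
  exact ⟨{
    rank := fun i => (s i).1
    d := fun i => d (s i)
    aug := π
    aug_surjective := hπ
    exact_aug := LinearMap.exact_iff.2 (hd (s 0)).symm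
    exact := fun i => LinearMap.exact_iff.2 (hd (s (i + 1))).symm }⟩

end FreeResolution

theorem extVanish_iff_extZero {R : Type u} [Ring R] [IsNoetherianRing R] {X W : Type u}
    [AddCommGroup X] [Module R X] [Module.Finite R X] [AddCommGroup W] [Module R W] (j : ℕ) :
    ExtVanish R X W j ↔ ExtZero R X W (j + 1) := by
  obtain ⟨F⟩ := FreeResolution.nonempty (R := R) (X := X)
  exact ⟨fun h => (F.exact_comp_iff_extZero j).1 (h F),
    fun h G => (G.exact_comp_iff_extZero j).2 h⟩

section Dual

variable {A : Type u} [Ring A] {X Y Z : Type u} [AddCommGroup X] [Module A X]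
  [AddCommGroup Y] [Module A Y] [AddCommGroup Z] [Module A Z]

/-- Evaluation of functionals at `x`, as an element of the double dual of `X`. -/
def dualEval (x : X) : (X →ₗ[A] A) →ₗ[Aᵐᵒᵖ] A where
  toFun φ := φ x
  map_add' _ _ := rfl
  map_smul' _ _ := rfl

/-- `X` is torsionless: functionals separate the points of `X`. -/
def IsTorsionless (A : Type u) [Ring A] (X : Type u) [AddCommGroup X] [Module A X] : Prop :=
  ∀ x : X, (∀ φ : X →ₗ[A] A, φ x = 0) → x = 0

/-- For `j = 0`, the map from `X` to its double dual is surjective; for `j ≥ 1`,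
`Ext^j(X*, A) = 0`.  This expresses the vanishing of `Ext^{j+2}(tr X, A)`. -/
def DualVanish (A : Type u) [Ring A] (X : Type u) [AddCommGroup X] [Module A X] : ℕ → Prop
  | 0 => ∀ Φ : (X →ₗ[A] A) →ₗ[Aᵐᵒᵖ] A, ∃ x : X, dualEval x = Φ
  | j + 1 => ExtZero Aᵐᵒᵖ (X →ₗ[A] A) A (j + 1)

theorem IsTorsionless.of_injective (hY : IsTorsionless A Y) {f : X →ₗ[A] Y}
    (hf : Injective f) : IsTorsionless A X := fun x hx =>
  hf ((hY (f x) fun φ => hx (φ ∘ₗ f)).trans f.map_zero.symm)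

theorem IsTorsionless.pi {ι : Type} (hX : IsTorsionless A X) : IsTorsionless A (ι → X) :=
  fun x hx => funext fun i => hX (x i) fun φ => hx (φ ∘ₗ LinearMap.proj i)

theorem isTorsionless_self : IsTorsionless A A := fun _ hx => hx LinearMap.id

theorem DualVanish.of_sum_comp_eq_id {ι : Type*} [Fintype ι] (p : ι → X →ₗ[A] Y)
    (s : ι → Y →ₗ[A] X) (h : ∀ x, ∑ i, s i (p i x) = x) {j : ℕ} (hY : DualVanish A Y j) :
    DualVanish A X j := by
  have hdual : ∀ φ : X →ₗ[A] A, ∑ i, dualMap (p i) (dualMap (s i) φ) = φ := fun φ => by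
    ext x
    rw [LinearMap.sum_apply]
    conv_rhs => rw [← h x, map_sum]
    rfl
  cases j with
  | zero =>
    intro Φ
    choose y hy using fun i => hY (Φ ∘ₗ dualMap (p i))
    refine ⟨∑ i, s i (y i), LinearMap.ext fun φ => ?_⟩
    conv_rhs => rw [← hdual φ, map_sum]
    refine (map_sum φ _ _).trans (Finset.sum_congr rfl fun i _ => ?_)
    exact LinearMap.congr_fun (hy i) (dualMap (s i) φ)
  | succ j =>
    exact extZero_of_sum_comp_eq_id (fun i => dualMap (s i)) (fun i => dualMap (p i)) hdual hY

theorem DualVanish.pi {n j : ℕ} (hX : DualVanish A X j) : DualVanish A (Fin n → X) j :=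
  hX.of_sum_comp_eq_id (fun i => LinearMap.proj i) (fun i => LinearMap.single A (fun _ => X) i)
    fun x => LinearMap.sum_single_apply _ x

theorem DualVanish.of_pi {n j : ℕ} (hn : 0 < n) (h : DualVanish A (Fin n → X) j) :
    DualVanish A X j :=
  h.of_sum_comp_eq_id (fun _ : Unit => LinearMap.single A (fun _ => X) ⟨0, hn⟩)
    (fun _ => LinearMap.proj ⟨0, hn⟩) fun x => by simp

theorem DualVanish.of_equiv {j : ℕ} (h : DualVanish A X j) (e : Y ≃ₗ[A] X) : DualVanish A Y j :=
  h.of_sum_comp_eq_id (fun _ : Unit => e.toLinearMap) (fun _ => e.symm.toLinearMap)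
    fun x => by simp

/-- The ring as a right module over itself, the dual of the left regular module. -/
def dualSelfEquiv (A : Type u) [Ring A] : (A →ₗ[A] A) ≃ₗ[Aᵐᵒᵖ] Aᵐᵒᵖ where
  toFun φ := MulOpposite.op (φ 1)
  invFun c := c • LinearMap.id
  map_add' _ _ := rfl
  map_smul' _ _ := rfl
  left_inv φ := by ext; simp
  right_inv c := by simp

theorem dualVanish_self (j : ℕ) : DualVanish A A j := by
  cases j with
  | zero =>
    refine fun Φ => ⟨Φ LinearMap.id, LinearMap.ext fun φ => ?_⟩
    have : φ = MulOpposite.op (φ 1) • LinearMap.id := by ext; simp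
    conv_rhs => rw [this, map_smul]
    conv_lhs => rw [this]
    rfl
  | succ j =>
    have := Module.Projective.of_equiv (dualSelfEquiv A).symm
    exact extZero_of_projective j

theorem dualVanish_free (n j : ℕ) : DualVanish A (Fin n → A) j := (dualVanish_self j).pi

theorem isTorsionless_free (n : ℕ) : IsTorsionless A (Fin n → A) := isTorsionless_self.pi

section ShortExact

variable {f : X →ₗ[A] Y} {g : Y →ₗ[A] Z}

theorem dualMap_injective (hg : Surjective g) : Injective (dualMap g) := fun _ _ h =>
  (LinearMap.cancel_right hg).1 h

theorem dualMap_exact (hg : Surjective g) (hfg : Exact f g) : Exact (dualMap g) (dualMap f) := by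
  intro ψ
  constructor
  · intro hψ
    obtain ⟨θ, hθ⟩ := exists_factor_of_surjective hg ψ fun y hy => by
      obtain ⟨x, rfl⟩ := (hfg y).1 hy
      exact LinearMap.congr_fun hψ x
    exact ⟨θ, hθ⟩
  · rintro ⟨θ, rfl⟩
    exact LinearMap.ext fun x => (congrArg θ (hfg.apply_apply_eq_zero x)).trans θ.map_zero

theorem DualVanish.kernel_zero (hfg : Exact f g)
    (hf' : Surjective (dualMap f)) (hZ : IsTorsionless A Z) (hY : DualVanish A Y 0) :
    DualVanish A X 0 := by
  intro Φ
  obtain ⟨y, hy⟩ := hY (Φ ∘ₗ dualMap f)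
  have hy' : ∀ ψ : Y →ₗ[A] A, ψ y = Φ (dualMap f ψ) := LinearMap.congr_fun hy
  obtain ⟨x, rfl⟩ := (hfg y).1 (hZ _ fun σ => by
    refine (hy' (σ ∘ₗ g)).trans ?_
    have : dualMap f (σ ∘ₗ g) = 0 :=
      LinearMap.ext fun x => (congrArg σ (hfg.apply_apply_eq_zero x)).trans σ.map_zero
    rw [this, map_zero])
  refine ⟨x, LinearMap.ext fun φ => ?_⟩
  obtain ⟨ψ, rfl⟩ := hf' φ
  exact hy' ψ

theorem DualVanish.kernel_succ (hg : Surjective g) (hfg : Exact f g)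
    (hf' : Surjective (dualMap f)) {j : ℕ} (hZ : DualVanish A Z j)
    (hY : DualVanish A Y (j + 1)) : DualVanish A X (j + 1) := by
  cases j with
  | zero =>
    refine extZero_one_of_forall_extend (dualMap_injective hg) hf' (dualMap_exact hg hfg)
      (fun Φ => ?_) hY
    obtain ⟨z, rfl⟩ := hZ Φ
    obtain ⟨y, rfl⟩ := hg z
    exact ⟨dualEval y, rfl⟩
  | succ j =>
    exact extZero_cokernel (dualMap_injective hg) hf' (dualMap_exact hg hfg) hZ hY

end ShortExact

end Dual

section Transpose

variable {A : Type u} [Ring A] {M : Type u} [AddCommGroup M] [Module A M]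
  (F : FreeResolution A M)

namespace FreeResolution

theorem exact_dualMap_aug :
    Exact (dualMap F.aug) (dualMap (F.d 0)).rangeRestrict := by
  intro ψ
  rw [← dualMap_exact F.aug_surjective F.exact_aug ψ]
  exact Subtype.ext_iff

theorem exact_range_transpose :
    Exact (LinearMap.range (dualMap (F.d 0))).subtype (LinearMap.range (dualMap (F.d 0))).mkQ :=
  LinearMap.exact_subtype_mkQ _

theorem extZero_transpose_one_iff :
    ExtZero Aᵐᵒᵖ F.transpose A 1 ↔ IsTorsionless A M := by
  constructor
  · intro h m hm
    obtain ⟨x, rfl⟩ := F.aug_surjective m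
    have hx : ∀ ψ, (dualMap (F.d 0)).rangeRestrict ψ = 0 → dualEval x ψ = 0 := fun ψ hψ => by
      obtain ⟨φ, rfl⟩ := (F.exact_dualMap_aug ψ).1 hψ
      exact hm φ
    obtain ⟨θ, hθ⟩ := exists_factor_of_surjective (R := Aᵐᵒᵖ) (W := A)
      (Z := LinearMap.range (dualMap (F.d 0)))
      (g := (dualMap (F.d 0)).rangeRestrict) (LinearMap.surjective_rangeRestrict _)
      (dualEval x) hx
    obtain ⟨Φ, rfl⟩ := exists_extend_of_extZero_one (Submodule.subtype_injective _)
      (Submodule.mkQ_surjective _) F.exact_range_transpose h θ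
    obtain ⟨y, rfl⟩ := dualVanish_free _ 0 Φ
    refine (F.exact_aug x).2 ⟨y, ?_⟩
    rw [← sub_eq_zero]
    refine isTorsionless_free _ _ fun ψ => ?_
    rw [map_sub, sub_eq_zero]
    exact LinearMap.congr_fun hθ ψ
  · intro h
    refine extZero_one_of_forall_extend (Submodule.subtype_injective _)
      (Submodule.mkQ_surjective _) F.exact_range_transpose (fun θ => ?_) (dualVanish_free _ 1)
    obtain ⟨x, hx⟩ := dualVanish_free _ 0 (θ ∘ₗ (dualMap (F.d 0)).rangeRestrict)
    obtain ⟨y, rfl⟩ := (F.exact_aug x).1 (h _ fun φ => by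
      refine (LinearMap.congr_fun hx (dualMap F.aug φ)).trans ?_
      have := F.exact_dualMap_aug.apply_apply_eq_zero φ
      rw [LinearMap.comp_apply, this, map_zero])
    refine ⟨dualEval y, LinearMap.ext ?_⟩
    rintro ⟨_, ψ, rfl⟩
    exact LinearMap.congr_fun hx ψ

theorem extZero_transpose_add_two_iff (j : ℕ) :
    ExtZero Aᵐᵒᵖ F.transpose A (j + 2) ↔ DualVanish A M j := by
  have hrange : ExtZero Aᵐᵒᵖ F.transpose A (j + 2) ↔
      ExtZero Aᵐᵒᵖ (LinearMap.range (dualMap (F.d 0))) A (j + 1) :=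
    ⟨fun h => extZero_kernel (Submodule.subtype_injective _)
      (Submodule.mkQ_surjective _) F.exact_range_transpose h (dualVanish_free _ (j + 1)),
    fun h => extZero_cokernel (Submodule.subtype_injective _)
      (Submodule.mkQ_surjective _) F.exact_range_transpose h (dualVanish_free _ (j + 2))⟩
  have hinj := dualMap_injective F.aug_surjective
  have hsurj := (dualMap (F.d 0)).surjective_rangeRestrict
  rw [hrange]
  cases j with
  | zero =>
    constructor
    · intro h Φ
      obtain ⟨Φ', rfl⟩ := exists_extend_of_extZero_one hinj hsurj F.exact_dualMap_aug h Φ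
      obtain ⟨x, rfl⟩ := dualVanish_free _ 0 Φ'
      exact ⟨F.aug x, rfl⟩
    · intro h
      refine extZero_one_of_forall_extend hinj hsurj F.exact_dualMap_aug (fun Φ => ?_)
        (dualVanish_free _ 1)
      obtain ⟨m, rfl⟩ := h Φ
      obtain ⟨x, rfl⟩ := F.aug_surjective m
      exact ⟨dualEval x, rfl⟩
  | succ j =>
    exact ⟨fun h => extZero_kernel hinj hsurj F.exact_dualMap_aug h (dualVanish_free _ (j + 1)),
      fun h => extZero_cokernel hinj hsurj F.exact_dualMap_aug h (dualVanish_free _ (j + 2))⟩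

end FreeResolution

instance [IsNoetherianRing Aᵐᵒᵖ] : Module.Finite Aᵐᵒᵖ F.transpose := by
  have : Module.Finite Aᵐᵒᵖ ((Fin (F.rank 1) → A) →ₗ[A] A) :=
    Module.Finite.of_surjective
      (∑ i : Fin (F.rank 1), dualMap (LinearMap.proj i) ∘ₗ
        (dualSelfEquiv A).symm.toLinearMap ∘ₗ LinearMap.proj i :
        (Fin (F.rank 1) → Aᵐᵒᵖ) →ₗ[Aᵐᵒᵖ] ((Fin (F.rank 1) → A) →ₗ[A] A))
      fun φ => ⟨fun i => MulOpposite.op (φ (Pi.single i 1)), by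
        refine LinearMap.pi_ext' fun i => LinearMap.ext_ring ?_
        simp [dualSelfEquiv, dualMap, Pi.single_apply]⟩
  infer_instance

theorem isTotallyReflexive_iff [IsNoetherianRing A] [IsNoetherianRing Aᵐᵒᵖ]
    [Module.Finite A M] :
    IsTotallyReflexive A M ↔ (∀ j, ExtZero A M A (j + 1)) ∧ IsTorsionless A M ∧
      ∀ j, DualVanish A M j := by
  unfold IsTotallyReflexive IsMNTorsionFree
  simp only [le_top, forall_const, extVanish_iff_extZero]
  refine and_congr_right fun _ => ⟨fun h => ?_, fun h F j => ?_⟩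
  · obtain ⟨F⟩ := FreeResolution.nonempty (R := A) (X := M)
    exact ⟨F.extZero_transpose_one_iff.1 (h F 0),
      fun j => (F.extZero_transpose_add_two_iff j).1 (h F (j + 1))⟩
  · cases j with
    | zero => exact F.extZero_transpose_one_iff.2 h.1
    | succ j => exact (F.extZero_transpose_add_two_iff j).2 (h.2 j)

end Transpose

section Syzygy

variable {A : Type u} [Ring A] {M : Type u} [AddCommGroup M] [Module A M]

theorem dualMap_surjective_of_extZero {X Y Z : Type u} [AddCommGroup X] [Module A X]
    [AddCommGroup Y] [Module A Y] [AddCommGroup Z] [Module A Z] {f : X →ₗ[A] Y} {g : Y →ₗ[A] Z}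
    (hf : Injective f) (hg : Surjective g) (hfg : Exact f g) (hZ : ExtZero A Z A 1) :
    Surjective (dualMap f) :=
  exists_extend_of_extZero_one hf hg hfg hZ

theorem FreeResolution.first_syzygy_vanish (F : FreeResolution A M) {n : ℕ}
    (hM : ∀ j, ExtZero A M A (j + 1)) (htf : IsTorsionless A M)
    (hdual : ∀ i < n, DualVanish A M i) :
    (∀ j, ExtZero A (LinearMap.range (F.d 0)) A (j + 1)) ∧
      ∀ i < n, DualVanish A (LinearMap.range (F.d 0)) i := by
  have hi := Submodule.subtype_injective (LinearMap.range (F.d 0))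
  have hs := dualMap_surjective_of_extZero hi F.aug_surjective F.exact_subtype_aug (hM 0)
  refine ⟨fun j => extZero_kernel hi F.aug_surjective F.exact_subtype_aug (hM (j + 1))
    (extZero_of_projective j), fun i hin => ?_⟩
  cases i with
  | zero => exact DualVanish.kernel_zero F.exact_subtype_aug hs htf (dualVanish_free _ 0)
  | succ i =>
    exact DualVanish.kernel_succ F.aug_surjective F.exact_subtype_aug hs
      (hdual i (by omega)) (dualVanish_free _ _)

/-- The vanishing of the `Ext`-groups and of the first obstructions to total reflexivity
passes from a module to its syzygies. -/
theorem FreeResolution.syzygy_vanish (F : FreeResolution A M) {n : ℕ}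
    (hM : ∀ j, ExtZero A M A (j + 1)) (htf : IsTorsionless A M)
    (hdual : ∀ i < n, DualVanish A M i) (t : ℕ) :
    (∀ j, ExtZero A (LinearMap.range (F.d t)) A (j + 1)) ∧
      ∀ i < n, DualVanish A (LinearMap.range (F.d t)) i := by
  induction t generalizing M with
  | zero => exact F.first_syzygy_vanish hM htf hdual
  | succ t ih =>
    have h := F.first_syzygy_vanish hM htf hdual
    exact ih F.tail h.1 ((isTorsionless_free _).of_injective (Submodule.subtype_injective _)) h.2

theorem IsNthSyzygy.vanish {S : Type u} [AddCommGroup S] [Module A S] {t n : ℕ}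
    (hS : IsNthSyzygy A M t S) (hM : ∀ j, ExtZero A M A (j + 1)) (htf : IsTorsionless A M)
    (hdual : ∀ i < n, DualVanish A M i) :
    (∀ j, ExtZero A S A (j + 1)) ∧ IsTorsionless A S ∧ ∀ i < n, DualVanish A S i := by
  cases t with
  | zero =>
    obtain ⟨e⟩ := hS
    exact ⟨fun j => (hM j).of_equiv e, htf.of_injective (f := e.toLinearMap) e.injective,
      fun i hi => (hdual i hi).of_equiv e⟩
  | succ t =>
    obtain ⟨F, ⟨e⟩⟩ := hS
    have h := F.syzygy_vanish hM htf hdual t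
    refine ⟨fun j => (h.1 j).of_equiv e, ?_, fun i hi => (h.2 i hi).of_equiv e⟩
    exact (isTorsionless_free _).of_injective
      (f := (LinearMap.range (F.d t)).subtype ∘ₗ e.toLinearMap)
      ((Submodule.subtype_injective _).comp e.injective)

end Syzygy

/-- **Key step in the proof of Corollary 2.6 (Araya–Takahashi).**
Let `Λ` be a left and right noetherian ring and `M, N` finitely generated
`Λ`-modules.  Suppose there is a short exact sequence
`0 → M^{⊕a} → N → Ω^t M^{⊕b} → 0` with `a, b > 0` and `t ≥ 0`, that `N` is
totally reflexive, and that `Ext_Λ^i(M, Λ) = 0` for all `i ≥ 1`.  Then `M` is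
totally reflexive. -/
theorem isTotallyReflexive_of_extension
    (A : Type u) [Ring A] [IsNoetherianRing A] [IsNoetherianRing Aᵐᵒᵖ]
    (M N S : Type u) [AddCommGroup M] [Module A M] [Module.Finite A M]
    [AddCommGroup N] [Module A N] [Module.Finite A N]
    [AddCommGroup S] [Module A S] [Module.Finite A S]
    (a b t : ℕ) (ha : 0 < a) (hb : 0 < b)
    (hS : IsNthSyzygy A M t S)
    (f : (Fin a → M) →ₗ[A] N) (g : N →ₗ[A] (Fin b → S))
    (hf : Function.Injective f) (hg : Function.Surjective g)
    (hfg : Function.Exact f g)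
    (hN : IsTotallyReflexive A N)
    (hM : ∀ j : ℕ, ExtVanish A M A j) :
    IsTotallyReflexive A M := by
  rw [isTotallyReflexive_iff] at hN ⊢
  obtain ⟨-, hNtf, hNdual⟩ := hN
  have hMext : ∀ j, ExtZero A M A (j + 1) := fun j => (extVanish_iff_extZero j).1 (hM j)
  have htf : IsTorsionless A M := (hNtf.of_injective hf).of_injective
    (f := LinearMap.single A (fun _ => M) ⟨0, ha⟩) (Pi.single_injective (M := fun _ => M) _)
  have hdual : ∀ n, ∀ i < n, DualVanish A M i := by
    intro n
    induction n with
    | zero => intro i hi; omega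
    | succ n ih =>
      obtain ⟨hSext, hStf, hSdual⟩ := hS.vanish hMext htf ih
      have hs := dualMap_surjective_of_extZero hf hg hfg (hSext 0).pi
      intro i hi
      refine DualVanish.of_pi ha ?_
      cases i with
      | zero => exact DualVanish.kernel_zero hfg hs hStf.pi (hNdual 0)
      | succ i =>
        exact DualVanish.kernel_succ hg hfg hs (hSdual i (by omega)).pi (hNdual _)
  exact ⟨hMext, htf, fun j => hdual (j + 1) j (by omega)⟩
end

section
/- Let k be a field and R = k[x,y]/(x², xy, y²). Then the residue field k of R satisfies red^pd_R k = 1 and ured^pd_R k = ∞; in particular ured^pd_R k > red^pd_R k. (Indeed, pd_R k = ∞ and there is a short exact sequence 0 → k^{⊕2} → R → k → 0 of R-modules, while R is not a complete intersection.) -/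
/-!
Formalization of a statement from:
T. Araya and R. Takahashi, "On reducing homological dimensions over noetherian
rings" (arXiv:2010.10765).
-/

open Function Filter CategoryTheory

universe u

/-- The artinian local ring `R = k[x,y]/(x², xy, y²)`. -/
noncomputable abbrev ExampleRing (k : Type u) [Field k] : Type u :=
  MvPolynomial (Fin 2) k ⧸
    (Ideal.span {MvPolynomial.X 0 ^ 2,
      MvPolynomial.X 0 * MvPolynomial.X 1,
      MvPolynomial.X 1 ^ 2} : Ideal (MvPolynomial (Fin 2) k))

/-- The maximal ideal `𝔪 = (x, y)` of `R = k[x,y]/(x², xy, y²)`. -/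
noncomputable abbrev ExampleMaxIdeal (k : Type u) [Field k] :
    Ideal (ExampleRing k) :=
  Ideal.span {Ideal.Quotient.mk _ (MvPolynomial.X 0),
    Ideal.Quotient.mk _ (MvPolynomial.X 1)}

section SquareZero

variable {A : Type u} [CommRing A]

/-- The length of a module as an integer (`0` if it is infinite). -/
noncomputable def intLength (A : Type u) [CommRing A] (M : Type u) [AddCommGroup M]
    [Module A M] : ℤ :=
  (Module.length A M).toNat

variable {M N P F : Type u} [AddCommGroup M] [Module A M] [AddCommGroup N] [Module A N]
  [AddCommGroup P] [Module A P] [AddCommGroup F] [Module A F]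

lemma LinearEquiv.intLength_eq (e : M ≃ₗ[A] N) : intLength A M = intLength A N := by
  rw [intLength, intLength, e.length_eq]

section Length

variable [IsArtinianRing A]

lemma intLength_eq_add_of_exact [Module.Finite A M] (f : N →ₗ[A] M) (g : M →ₗ[A] P)
    (hf : Injective f) (hg : Surjective g) (h : Exact f g) :
    intLength A M = intLength A N + intLength A P := by
  have hM : Module.length A M ≠ ⊤ := Module.length_ne_top
  have hN : Module.length A N ≠ ⊤ :=
    ne_top_of_le_ne_top hM (Module.length_le_of_injective f hf)
  have hP : Module.length A P ≠ ⊤ :=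
    ne_top_of_le_ne_top hM (Module.length_le_of_surjective g hg)
  rw [intLength, Module.length_eq_add_of_exact f g hf hg h, ENat.toNat_add hN hP]
  simp [intLength]

lemma intLength_eq_ker_add [Module.Finite A M] (g : M →ₗ[A] P) (hg : Surjective g) :
    intLength A M = intLength A (LinearMap.ker g) + intLength A P :=
  intLength_eq_add_of_exact _ g (Submodule.subtype_injective _) hg
    (LinearMap.exact_subtype_ker_map g)

lemma intLength_eq_ker_add_range [Module.Finite A M] (g : M →ₗ[A] P) :
    intLength A M = intLength A (LinearMap.ker g) + intLength A (LinearMap.range g) := by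
  have h := intLength_eq_ker_add g.rangeRestrict g.surjective_rangeRestrict
  rwa [LinearMap.ker_rangeRestrict] at h

lemma intLength_prod [Module.Finite A M] [Module.Finite A N] :
    intLength A (M × N) = intLength A M + intLength A N :=
  intLength_eq_add_of_exact _ _ LinearMap.inl_injective LinearMap.snd_surjective .inl_snd

lemma intLength_ker_prodMap_self [Module.Finite A M] (g : M →ₗ[A] P) :
    intLength A (LinearMap.ker (g.prodMap g)) =
      2 * intLength A M - 2 * intLength A (LinearMap.range g) := by
  have h := intLength_eq_ker_add (g.rangeRestrict.prodMap g.rangeRestrict)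
    (g.surjective_rangeRestrict.prodMap g.surjective_rangeRestrict)
  rw [LinearMap.ker_prodMap, LinearMap.ker_rangeRestrict, ← LinearMap.ker_prodMap,
    intLength_prod, intLength_prod] at h
  linarith

lemma Submodule.eq_of_le_of_intLength_eq [Module.Finite A M] {p q : Submodule A M}
    (hpq : p ≤ q) (h : intLength A p = intLength A q) : p = q := by
  by_contra hne
  have hlt := Submodule.height_strictMono (lt_of_le_of_ne hpq hne)
  rw [← Module.length_submodule, ← Module.length_submodule] at hlt
  have hp : Module.length A p ≠ ⊤ := Module.length_ne_top
  have hq : Module.length A q ≠ ⊤ := Module.length_ne_top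
  rw [intLength, intLength, Nat.cast_inj] at h
  rw [← ENat.natCast_toNat hp, ← ENat.natCast_toNat hq, h] at hlt
  exact hlt.false

end Length

variable (x y : A)

/-- The map `(a, b) ↦ x a + y b`; its range is `(x, y) M`. -/
def pairMap (M : Type u) [AddCommGroup M] [Module A M] : M × M →ₗ[A] M :=
  (LinearMap.lsmul A M x).coprod (LinearMap.lsmul A M y)

@[simp]
lemma pairMap_apply (p : M × M) : pairMap x y M p = x • p.1 + y • p.2 := rfl

lemma map_pairMap (f : M →ₗ[A] N) (p : M × M) :
    f (pairMap x y M p) = pairMap x y N (f.prodMap f p) := by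
  simp

/-- The top `M / (x, y) M` of `M`. -/
abbrev ModuleTop (M : Type u) [AddCommGroup M] [Module A M] : Type u :=
  M ⧸ LinearMap.range (pairMap x y M)

/-- The quotient map `M → M / (x, y) M`. -/
abbrev topMap (M : Type u) [AddCommGroup M] [Module A M] : M →ₗ[A] ModuleTop x y M :=
  (LinearMap.range (pairMap x y M)).mkQ

/-- The first Betti number `3 μ(M) - ℓ(M)` of `M`, where `μ(M)` is the length of
`M / (x, y) M`. It vanishes on free modules and doubles under passage to syzygies. -/
noncomputable def defect (M : Type u) [AddCommGroup M] [Module A M] : ℤ :=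
  3 * intLength A (ModuleTop x y M) - intLength A M

/-- `x a + y b = 0` holds in `F` only if `a` and `b` lie in `(x, y) F`. -/
def HasTrivialRelations (F : Type u) [AddCommGroup F] [Module A F] : Prop :=
  LinearMap.ker (pairMap x y F) ≤ LinearMap.ker ((topMap x y F).prodMap (topMap x y F))

variable {x y}

lemma topMap_eq_zero_iff {a : M} :
    topMap x y M a = 0 ↔ ∃ b c : M, x • b + y • c = a := by
  simp

lemma LinearEquiv.defect_eq (e : M ≃ₗ[A] N) : defect x y M = defect x y N := by
  rw [defect, defect, e.intLength_eq]
  refine congrArg (3 * · - _) (LinearEquiv.intLength_eq (Submodule.Quotient.equiv _ _ e ?_))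
  ext a
  constructor
  · rintro ⟨_, ⟨p, rfl⟩, rfl⟩
    exact ⟨(e p.1, e p.2), by simp⟩
  · rintro ⟨p, rfl⟩
    exact ⟨x • e.symm p.1 + y • e.symm p.2, ⟨(e.symm p.1, e.symm p.2), rfl⟩, by simp⟩

lemma defect_eq_zero_of_subsingleton [Subsingleton M] : defect x y M = 0 := by
  simp [defect, intLength]

lemma HasTrivialRelations.pi (h : HasTrivialRelations x y A) (n : ℕ) :
    HasTrivialRelations x y (Fin n → A) := by
  rintro ⟨a, b⟩ hab
  have key : ∀ i, topMap x y A (a i) = 0 ∧ topMap x y A (b i) = 0 := fun i => by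
    have := @h (a i, b i) (by simpa using congrFun hab i)
    simpa only [LinearMap.mem_ker, LinearMap.prodMap_apply, Prod.mk_eq_zero] using this
  simp only [topMap_eq_zero_iff] at key
  choose c d hcd using fun i => (key i).1
  choose c' d' hcd' using fun i => (key i).2
  simp only [LinearMap.mem_ker, LinearMap.prodMap_apply, Prod.mk_eq_zero, topMap_eq_zero_iff]
  exact ⟨⟨c, d, funext hcd⟩, ⟨c', d', funext hcd'⟩⟩

/-- The ideal generated by `x` and `y` has square zero. -/
structure IsSquareZeroPair (x y : A) : Prop where
  xx : x * x = 0
  xy : x * y = 0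
  yy : y * y = 0

lemma IsSquareZeroPair.ker_le (hs : IsSquareZeroPair x y) :
    LinearMap.ker ((topMap x y M).prodMap (topMap x y M)) ≤ LinearMap.ker (pairMap x y M) := by
  rintro ⟨a, b⟩ hab
  simp only [LinearMap.mem_ker, LinearMap.prodMap_apply, Prod.mk_eq_zero,
    topMap_eq_zero_iff] at hab
  obtain ⟨⟨c, d, rfl⟩, ⟨c', d', rfl⟩⟩ := hab
  simp [smul_smul, hs.xx, hs.xy, hs.yy, mul_comm y x]

variable [IsArtinianRing A]

lemma intLength_eq_range_add_top [Module.Finite A M] :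
    intLength A M =
      intLength A (LinearMap.range (pairMap x y M)) + intLength A (ModuleTop x y M) := by
  have h := intLength_eq_ker_add (topMap x y M) (Submodule.mkQ_surjective _)
  rwa [Submodule.ker_mkQ] at h

lemma two_mul_intLength [Module.Finite A M] :
    2 * intLength A M =
      intLength A (LinearMap.ker (pairMap x y M)) +
        intLength A (LinearMap.range (pairMap x y M)) := by
  rw [← intLength_eq_ker_add_range, intLength_prod, two_mul]

lemma intLength_ker_topMap_prodMap [Module.Finite A M] :
    intLength A (LinearMap.ker ((topMap x y M).prodMap (topMap x y M))) =
      2 * intLength A M - 2 * intLength A (ModuleTop x y M) := by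
  rw [intLength_ker_prodMap_self, Submodule.range_mkQ, Submodule.topEquiv.intLength_eq]

lemma HasTrivialRelations.of_defect_eq_zero (hs : IsSquareZeroPair x y) [Module.Finite A M]
    (h : defect x y M = 0) : HasTrivialRelations x y M := by
  refine (Submodule.eq_of_le_of_intLength_eq hs.ker_le ?_).ge
  have h₁ := intLength_eq_range_add_top (x := x) (y := y) (M := M)
  have h₂ := two_mul_intLength (x := x) (y := y) (M := M)
  rw [intLength_ker_topMap_prodMap]
  rw [defect] at h
  linarith

lemma HasTrivialRelations.intLength_eq (hs : IsSquareZeroPair x y) [Module.Finite A F]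
    (hF : HasTrivialRelations x y F) :
    intLength A F = 3 * intLength A (ModuleTop x y F) := by
  have h₁ := intLength_eq_range_add_top (x := x) (y := y) (M := F)
  have h₂ := two_mul_intLength (x := x) (y := y) (M := F)
  rw [le_antisymm hF hs.ker_le, intLength_ker_topMap_prodMap] at h₂
  linarith

lemma HasTrivialRelations.defect_eq_two_mul (hs : IsSquareZeroPair x y) [Module.Finite A F]
    (hF : HasTrivialRelations x y F) (f : N →ₗ[A] F) (g : F →ₗ[A] M)
    (hf : Injective f) (hg : Surjective g) (h : Exact f g) :
    defect x y N = 2 * defect x y M := by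
  have : Module.Finite A N := Module.Finite.of_injective f hf
  have : Module.Finite A M := Module.Finite.of_surjective g hg
  let t : N →ₗ[A] ModuleTop x y F := topMap x y F ∘ₗ f
  have hker : LinearMap.ker (pairMap x y N) = LinearMap.ker (t.prodMap t) := by
    ext p
    have e₁ : p ∈ LinearMap.ker (pairMap x y N) ↔
        f.prodMap f p ∈ LinearMap.ker (pairMap x y F) := by
      rw [LinearMap.mem_ker, LinearMap.mem_ker, ← map_pairMap, map_eq_zero_iff f hf]
    rw [e₁, le_antisymm hF hs.ker_le]
    rfl
  let gTop : ModuleTop x y F →ₗ[A] ModuleTop x y M :=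
    Submodule.mapQ _ _ g (by
      rintro _ ⟨p, rfl⟩
      exact ⟨g.prodMap g p, (map_pairMap x y g p).symm⟩)
  have hgTop : Surjective gTop := by
    intro z
    obtain ⟨m, rfl⟩ := Submodule.mkQ_surjective _ z
    obtain ⟨a, rfl⟩ := hg m
    exact ⟨topMap x y F a, rfl⟩
  have hrange : LinearMap.ker gTop = LinearMap.range t := by
    ext z
    obtain ⟨a, rfl⟩ := Submodule.mkQ_surjective _ z
    constructor
    · intro ha
      obtain ⟨b, c, hbc⟩ := topMap_eq_zero_iff.1 (show topMap x y M (g a) = 0 from ha)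
      obtain ⟨b, rfl⟩ := hg b
      obtain ⟨c, rfl⟩ := hg c
      obtain ⟨n, hn⟩ := (h (a - (x • b + y • c))).1 (by simp [hbc])
      refine ⟨n, ?_⟩
      change topMap x y F (f n) = topMap x y F a
      rw [hn, map_sub, topMap_eq_zero_iff.2 ⟨b, c, rfl⟩, sub_zero]
    · rintro ⟨n, hn⟩
      rw [← hn]
      change topMap x y M (g (f n)) = 0
      rw [h.apply_apply_eq_zero, map_zero]
  have h₁ := intLength_eq_range_add_top (x := x) (y := y) (M := N)
  have h₂ := two_mul_intLength (x := x) (y := y) (M := N)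
  have h₃ := intLength_eq_ker_add gTop hgTop
  have h₄ := intLength_eq_add_of_exact f g hf hg h
  have h₅ := hF.intLength_eq hs
  rw [hker, intLength_ker_prodMap_self] at h₂
  rw [hrange] at h₃
  rw [defect, defect]
  linarith

lemma FreeResolution.defect_range (hs : IsSquareZeroPair x y)
    (hA : HasTrivialRelations x y A) (R : FreeResolution A M) (i : ℕ) :
    defect x y (LinearMap.range (R.d i)) = 2 ^ (i + 1) * defect x y M := by
  induction i with
  | zero =>
    rw [show (2 : ℤ) ^ (0 + 1) = 2 by norm_num]
    refine (hA.pi _).defect_eq_two_mul hs _ R.aug (Submodule.subtype_injective _)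
      R.aug_surjective ?_
    intro a
    simpa using R.exact_aug a
  | succ i ih =>
    rw [pow_succ', mul_assoc, ← ih]
    refine (hA.pi _).defect_eq_two_mul hs _ (R.d i).rangeRestrict
      (Submodule.subtype_injective _) (R.d i).surjective_rangeRestrict ?_
    intro a
    simpa [Subtype.ext_iff] using R.exact i a

lemma HasFinitePd.defect_eq_zero (hs : IsSquareZeroPair x y)
    (hA : HasTrivialRelations x y A) (h : HasFinitePd A M) : defect x y M = 0 := by
  obtain ⟨R, t, ht⟩ := h
  have h₁ := R.defect_range hs hA t
  have : IsEmpty (Fin (R.rank t)) := by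
    rw [ht t le_rfl]
    infer_instance
  rw [defect_eq_zero_of_subsingleton] at h₁
  simpa using h₁

lemma IsNthSyzygy.defect_eq (hs : IsSquareZeroPair x y)
    (hA : HasTrivialRelations x y A) {n : ℕ} (h : IsNthSyzygy A M n N) :
    defect x y N = 2 ^ n * defect x y M := by
  cases n with
  | zero =>
    obtain ⟨e⟩ := h
    simpa using e.defect_eq
  | succ n =>
    obtain ⟨R, ⟨e⟩⟩ := h
    rw [e.defect_eq, R.defect_range hs hA]

lemma URedChain.defect_eq_zero (hs : IsSquareZeroPair x y)
    (hA : HasTrivialRelations x y A) {s : ℕ} (h : URedChain A (HasFinitePd A) s M) :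
    defect x y M = 0 := by
  induction s generalizing M with
  | zero => exact HasFinitePd.defect_eq_zero hs hA h
  | succ s ih =>
    obtain ⟨M₁, _, _, _, S, _, _, _, n, f, g, hS, hf, hg, hfg, hM₁⟩ := h
    have h₁ := (HasTrivialRelations.of_defect_eq_zero hs (ih hM₁)).defect_eq_two_mul hs
      f g hf hg hfg
    rw [hS.defect_eq hs hA] at h₁
    have h₂ : (1 : ℤ) ≤ 2 ^ n := one_le_pow₀ (by norm_num)
    have h₃ : (2 * 2 ^ n - 1) * defect x y M = 0 := by linear_combination -h₁
    exact (mul_eq_zero.1 h₃).resolve_left (by linarith)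

end SquareZero

namespace ExampleRing

variable (k : Type u) [Field k]

/-- The class of the first variable in `k[x,y]/(x², xy, y²)`. -/
noncomputable abbrev x : ExampleRing k := Ideal.Quotient.mk _ (MvPolynomial.X 0)

/-- The class of the second variable in `k[x,y]/(x², xy, y²)`. -/
noncomputable abbrev y : ExampleRing k := Ideal.Quotient.mk _ (MvPolynomial.X 1)

lemma isSquareZeroPair : IsSquareZeroPair (x k) (y k) where
  xx := by
    rw [← map_mul, Ideal.Quotient.eq_zero_iff_mem, ← pow_two]
    exact Ideal.subset_span (by simp)
  xy := by
    rw [← map_mul, Ideal.Quotient.eq_zero_iff_mem]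
    exact Ideal.subset_span (by simp)
  yy := by
    rw [← map_mul, Ideal.Quotient.eq_zero_iff_mem, ← pow_two]
    exact Ideal.subset_span (by simp)

variable {k}

/-- The homomorphism `k[x,y]/(x², xy, y²) → k[ε]` sending `x` and `y` to `a ε` and `b ε`. -/
noncomputable def toDualNumber (a b : k) : ExampleRing k →+* DualNumber k :=
  Ideal.Quotient.lift _
    (MvPolynomial.aeval ![TrivSqZeroExt.inr a, TrivSqZeroExt.inr b] :
      MvPolynomial (Fin 2) k →ₐ[k] DualNumber k).toRingHom (by
    intro p hp
    refine (Ideal.span_le (I := RingHom.ker _)).2 ?_ hp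
    rintro q (rfl | rfl | rfl) <;> simp [RingHom.mem_ker, pow_two])

lemma toDualNumber_x (a b : k) : toDualNumber a b (x k) = TrivSqZeroExt.inr a := by
  simp [toDualNumber]

lemma toDualNumber_y (a b : k) : toDualNumber a b (y k) = TrivSqZeroExt.inr b := by
  simp [toDualNumber]

variable (k) in
/-- The residue map `k[x,y]/(x², xy, y²) → k`. -/
noncomputable def residue : ExampleRing k →+* k :=
  Ideal.Quotient.lift _ MvPolynomial.constantCoeff (by
    intro p hp
    refine (Ideal.span_le (I := RingHom.ker _)).2 ?_ hp
    rintro q (rfl | rfl | rfl) <;> simp [RingHom.mem_ker])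

lemma fst_toDualNumber (a b : k) (r : ExampleRing k) :
    (toDualNumber a b r).fst = residue k r := by
  obtain ⟨p, rfl⟩ := Ideal.Quotient.mk_surjective r
  change (MvPolynomial.aeval _ p : DualNumber k).fst = MvPolynomial.constantCoeff p
  induction p using MvPolynomial.induction_on with
  | C c => simp [TrivSqZeroExt.algebraMap_eq_inl]
  | add p q hp hq => rw [map_add, map_add, TrivSqZeroExt.fst_add, hp, hq]
  | mul_X p i hp => fin_cases i <;> simp

lemma residue_x : residue k (x k) = 0 := MvPolynomial.constantCoeff_X _ _

lemma residue_y : residue k (y k) = 0 := MvPolynomial.constantCoeff_X _ _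

lemma residue_surjective : Surjective (residue k) := fun c =>
  ⟨Ideal.Quotient.mk _ (MvPolynomial.C c), MvPolynomial.constantCoeff_C _ c⟩

lemma mem_exampleMaxIdeal_iff {r : ExampleRing k} :
    r ∈ ExampleMaxIdeal k ↔ ∃ a b, x k * a + y k * b = r := by
  simp [Ideal.mem_span_pair, mul_comm]

lemma residue_eq_zero_iff {r : ExampleRing k} :
    residue k r = 0 ↔ r ∈ ExampleMaxIdeal k := by
  constructor
  · obtain ⟨p, rfl⟩ := Ideal.Quotient.mk_surjective r
    intro h
    have key : Ideal.Quotient.mk _ (p - MvPolynomial.C (MvPolynomial.constantCoeff p)) ∈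
        ExampleMaxIdeal k := by
      clear h
      induction p using MvPolynomial.induction_on with
      | C c => simp
      | add p q hp hq =>
        convert add_mem hp hq using 1
        simp only [map_sub, map_add]
        ring
      | mul_X p i hp =>
        simp only [map_mul, MvPolynomial.constantCoeff_X, mul_zero, map_zero, sub_zero]
        refine Ideal.mul_mem_left _ _ (Ideal.subset_span ?_)
        fin_cases i <;> simp
    rw [show MvPolynomial.constantCoeff p = 0 from h, map_zero, sub_zero] at key
    exact key
  · rw [mem_exampleMaxIdeal_iff]
    rintro ⟨a, b, rfl⟩
    rw [map_add, map_mul, map_mul, residue_x, residue_y, zero_mul, zero_mul, add_zero]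

lemma mem_of_mul_add_mul_eq_zero {r s : ExampleRing k} (h : x k * r + y k * s = 0) :
    r ∈ ExampleMaxIdeal k ∧ s ∈ ExampleMaxIdeal k := by
  have key (a b : k) : a * residue k r + b * residue k s = 0 := by
    have := congrArg (fun t => (toDualNumber a b t).snd) h
    simpa [toDualNumber_x, toDualNumber_y, fst_toDualNumber, -map_eq_zero, mul_comm] using this
  rw [← residue_eq_zero_iff, ← residue_eq_zero_iff]
  exact ⟨by simpa using key 1 0, by simpa using key 0 1⟩

variable (k)

lemma hasTrivialRelations : HasTrivialRelations (x k) (y k) (ExampleRing k) := by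
  rintro ⟨r, s⟩ hrs
  have h := mem_of_mul_add_mul_eq_zero (r := r) (s := s) hrs
  rw [mem_exampleMaxIdeal_iff, mem_exampleMaxIdeal_iff] at h
  simp only [LinearMap.mem_ker, LinearMap.prodMap_apply, Prod.mk_eq_zero, topMap_eq_zero_iff]
  exact h

lemma isMaximal_exampleMaxIdeal : (ExampleMaxIdeal k).IsMaximal := by
  have : ExampleMaxIdeal k = RingHom.ker (residue k) := by
    ext r
    rw [RingHom.mem_ker, residue_eq_zero_iff]
  rw [this]
  exact RingHom.ker_isMaximal_of_surjective _ residue_surjective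

/-- The residue field `R/𝔪` of `R = k[x,y]/(x², xy, y²)`. -/
abbrev ResidueModule : Type u := ExampleRing k ⧸ ExampleMaxIdeal k

lemma length_residueModule : Module.length (ExampleRing k) (ResidueModule k) = 1 := by
  rw [Module.length_eq_one_iff]
  have := isMaximal_exampleMaxIdeal k
  exact isSimpleModule_iff_isCoatom.2 this.out

/-- Multiplication by `r ∈ R` with `𝔪 r = 0`, as a map `R/𝔪 → R`. -/
noncomputable def mulResidue (r : ExampleRing k) (hr : ∀ s ∈ ExampleMaxIdeal k, s * r = 0) :
    ResidueModule k →ₗ[ExampleRing k] ExampleRing k :=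
  Submodule.liftQ _ (LinearMap.toSpanSingleton _ _ r) hr

lemma mul_x_eq_zero (s : ExampleRing k) (hs : s ∈ ExampleMaxIdeal k) : s * x k = 0 := by
  obtain ⟨a, b, rfl⟩ := mem_exampleMaxIdeal_iff.1 hs
  linear_combination a * (isSquareZeroPair k).xx + b * (isSquareZeroPair k).xy

lemma mul_y_eq_zero (s : ExampleRing k) (hs : s ∈ ExampleMaxIdeal k) : s * y k = 0 := by
  obtain ⟨a, b, rfl⟩ := mem_exampleMaxIdeal_iff.1 hs
  linear_combination a * (isSquareZeroPair k).xy + b * (isSquareZeroPair k).yy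

/-- The map `(R/𝔪)² → R` sending `(a, b)` to `x a + y b`. -/
noncomputable def socleMap :
    (Fin 2 → ResidueModule k) →ₗ[ExampleRing k] ExampleRing k :=
  mulResidue k (x k) (mul_x_eq_zero k) ∘ₗ LinearMap.proj 0 +
    mulResidue k (y k) (mul_y_eq_zero k) ∘ₗ LinearMap.proj 1

lemma socleMap_mk (a : Fin 2 → ExampleRing k) :
    socleMap k (fun i => Ideal.Quotient.mk _ (a i)) = x k * a 0 + y k * a 1 := by
  rw [mul_comm (x k), mul_comm (y k)]
  rfl

lemma exists_mk_eq (v : Fin 2 → ResidueModule k) :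
    ∃ a : Fin 2 → ExampleRing k, (fun i => Ideal.Quotient.mk _ (a i)) = v :=
  ⟨fun i => (Ideal.Quotient.mk_surjective (v i)).choose,
    funext fun i => (Ideal.Quotient.mk_surjective (v i)).choose_spec⟩

lemma socleMap_injective : Injective (socleMap k) := by
  rw [injective_iff_map_eq_zero]
  intro v hv
  obtain ⟨a, rfl⟩ := exists_mk_eq k v
  rw [socleMap_mk] at hv
  obtain ⟨h₀, h₁⟩ := mem_of_mul_add_mul_eq_zero hv
  funext i
  fin_cases i
  · exact Ideal.Quotient.eq_zero_iff_mem.2 h₀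
  · exact Ideal.Quotient.eq_zero_iff_mem.2 h₁

lemma exact_socleMap : Exact (socleMap k) (ExampleMaxIdeal k).mkQ := by
  intro r
  rw [Submodule.mkQ_apply, Submodule.Quotient.mk_eq_zero, mem_exampleMaxIdeal_iff]
  constructor
  · rintro ⟨a, b, rfl⟩
    exact ⟨_, socleMap_mk k ![a, b]⟩
  · rintro ⟨v, rfl⟩
    obtain ⟨a, rfl⟩ := exists_mk_eq k v
    exact ⟨_, _, (socleMap_mk k a).symm⟩

instance : IsArtinianRing (ExampleRing k) := by
  rw [isArtinianRing_iff_isFiniteLength, ← Module.length_ne_top_iff,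
    Module.length_eq_add_of_exact _ _ (socleMap_injective k) (Submodule.mkQ_surjective _)
      (exact_socleMap k)]
  simp [length_residueModule, Module.length_pi_of_fintype]

lemma defect_residueModule : defect (x k) (y k) (ResidueModule k) = 2 := by
  have hbot : LinearMap.range (pairMap (x k) (y k) (ResidueModule k)) = ⊥ := by
    rw [eq_bot_iff]
    rintro _ ⟨⟨u, v⟩, rfl⟩
    obtain ⟨r, rfl⟩ := Submodule.mkQ_surjective _ u
    obtain ⟨s, rfl⟩ := Submodule.mkQ_surjective _ v
    refine (map_pairMap (x k) (y k) (ExampleMaxIdeal k).mkQ (r, s)).symm.trans ?_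
    rw [Submodule.mkQ_apply, Submodule.Quotient.mk_eq_zero]
    exact mem_exampleMaxIdeal_iff.2 ⟨r, s, rfl⟩
  rw [defect, (Submodule.quotEquivOfEqBot _ hbot).intLength_eq, intLength,
    length_residueModule]
  norm_num

end ExampleRing

/-- The trivial resolution of `A` as a module over itself. -/
def FreeResolution.self (A : Type u) [Ring A] : FreeResolution A A where
  rank i := if i = 0 then 1 else 0
  d _ := 0
  aug := LinearMap.proj (0 : Fin 1)
  aug_surjective a := ⟨fun _ => a, rfl⟩
  exact_aug a := by
    constructor
    · intro h
      refine ⟨0, funext fun i => ?_⟩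
      rw [show i = (0 : Fin 1) from Subsingleton.elim (α := Fin 1) i 0]
      exact h.symm
    · rintro ⟨_, rfl⟩
      rfl
  exact i a := by
    have : IsEmpty (Fin (if i + 1 = 0 then 1 else 0)) := by
      rw [if_neg i.succ_ne_zero]
      infer_instance
    exact ⟨fun _ => ⟨0, Subsingleton.elim _ _⟩, fun _ => rfl⟩

lemma HasFinitePd.self (A : Type u) [Ring A] : HasFinitePd A A :=
  ⟨FreeResolution.self A, 1, fun i hi => if_neg (by omega)⟩

lemma ExampleRing.redChain_one (k : Type u) [Field k] :
    RedChain (ExampleRing k) (HasFinitePd (ExampleRing k)) 1 (ResidueModule k) := by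
  refine ⟨ExampleRing k, _, _, inferInstance, ResidueModule k, _, _, inferInstance, 2, 1, 0,
    socleMap k, LinearMap.pi fun _ => (ExampleMaxIdeal k).mkQ, two_pos, one_pos,
    ⟨LinearEquiv.refl _ _⟩, socleMap_injective k, ?_, ?_, HasFinitePd.self _⟩
  · intro v
    obtain ⟨r, hr⟩ := Submodule.mkQ_surjective _ (v 0)
    refine ⟨r, funext fun i => ?_⟩
    rw [Subsingleton.elim i 0]
    exact hr
  · intro r
    rw [← exact_socleMap k r]
    simp [funext_iff]

/-- **Example 3.9 (Araya–Takahashi).**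
Let `k` be a field and `R = k[x,y]/(x², xy, y²)`, a local ring with maximal ideal
`𝔪 = (x, y)` and residue field `k = R/𝔪`.  Then `pd_R k = ∞`,
`red-pd_R k = 1` and `ured-pd_R k = ∞`; in particular
`ured-pd_R k > red-pd_R k`. -/
theorem example_redPd_lt_uredPd (k : Type u) [Field k] :
    ¬ HasFinitePd (ExampleRing k) (ExampleRing k ⧸ ExampleMaxIdeal k) ∧
    redDim (ExampleRing k) (HasFinitePd (ExampleRing k))
      (ExampleRing k ⧸ ExampleMaxIdeal k) = 1 ∧
    uredDim (ExampleRing k) (HasFinitePd (ExampleRing k))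
      (ExampleRing k ⧸ ExampleMaxIdeal k) = ⊤ ∧
    redDim (ExampleRing k) (HasFinitePd (ExampleRing k))
      (ExampleRing k ⧸ ExampleMaxIdeal k) <
    uredDim (ExampleRing k) (HasFinitePd (ExampleRing k))
      (ExampleRing k ⧸ ExampleMaxIdeal k) := by
  have hpd : ¬ HasFinitePd (ExampleRing k) (ExampleRing k ⧸ ExampleMaxIdeal k) := by
    intro h
    have h₁ := h.defect_eq_zero (ExampleRing.isSquareZeroPair k)
      (ExampleRing.hasTrivialRelations k)
    rw [ExampleRing.defect_residueModule] at h₁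
    norm_num at h₁
  have hred : redDim (ExampleRing k) (HasFinitePd (ExampleRing k))
      (ExampleRing k ⧸ ExampleMaxIdeal k) = 1 := by
    refine le_antisymm (sInf_le ⟨1, by simp, ExampleRing.redChain_one k⟩) (le_sInf ?_)
    rintro _ ⟨t, rfl, ht⟩
    cases t with
    | zero => exact absurd ht hpd
    | succ t => simp
  have hured : uredDim (ExampleRing k) (HasFinitePd (ExampleRing k))
      (ExampleRing k ⧸ ExampleMaxIdeal k) = ⊤ := by
    refine sInf_eq_top.2 ?_
    rintro _ ⟨t, rfl, ht⟩
    have h₁ := ht.defect_eq_zero (ExampleRing.isSquareZeroPair k)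
      (ExampleRing.hasTrivialRelations k)
    rw [ExampleRing.defect_residueModule] at h₁
    norm_num at h₁
  refine ⟨hpd, hred, hured, ?_⟩
  rw [hred, hured]
  exact ENat.natCast_lt_top 1
end
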